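/- arXiv:1007.4658 — 2 statements merged into one kernel-verified Lean document; each statement's English description precedes it below -/
import Mathlib

section
/- For every γ ∈ ℝ≥0 with 0 < γ, the R-module R/𝒫_γ has finite length. Consequently, for every γ > 0 the set {δ ∈ Φ : γ ≤ δ} is finite (the value semigroup Φ contains no infinite bounded sequences). -/
/-!
Statement context. Let `(R, M)` be a noetherian local domain which is not a field, with field of
fractions `K`, and let `ν : K → ℝ≥0` be a (multiplicatively written) valuation which is ≤ 1 on `R`
and < 1 on `M` (i.e. `ν` is a nontrivial rank-one valuation centered at `R`).  For `γ ∈ ℝ≥0` let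
`𝒫_γ = {x ∈ R | ν x ≤ γ}` and let `Φ = ν(R \ {0})`.  Then the implicit ideal
`H = ⋂_{γ ∈ Φ} 𝒫_γ·R̂` of the `M`-adic completion `R̂` of `R` is prime.
-/

open IsLocalRing
open scoped NNReal

/-- The valuation ideal `𝒫_γ = {x ∈ R | ν (f x) ≤ γ}`, for a valuation `ν` on a ring `K`
and a ring homomorphism `f : R → K` such that `ν ∘ f` is bounded by `1` on `R`. -/
def valIdeal {R K : Type*} [CommRing R] [CommRing K] (f : R →+* K)
    (ν : Valuation K ℝ≥0) (hν : ∀ x : R, ν (f x) ≤ 1) (γ : ℝ≥0) : Ideal R where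
  carrier := {x : R | ν (f x) ≤ γ}
  add_mem' := fun {a b} ha hb => by
    simp only [Set.mem_setOf_eq, map_add] at *
    exact le_trans (ν.map_add _ _) (max_le ha hb)
  zero_mem' := by simp
  smul_mem' := fun c x hx => by
    simp only [smul_eq_mul, Set.mem_setOf_eq, map_mul] at *
    calc ν (f c) * ν (f x) ≤ 1 * γ := mul_le_mul' (hν c) hx
      _ = γ := one_mul γ

/-- The value semigroup `Φ = ν(R \ {0})`. -/
def valSemigroup {R K : Type*} [CommRing R] [CommRing K] (f : R →+* K)
    (ν : Valuation K ℝ≥0) : Set ℝ≥0 :=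
  {γ : ℝ≥0 | ∃ x : R, x ≠ 0 ∧ ν (f x) = γ}

/-- The implicit ideal `H = ⋂_{γ ∈ Φ} 𝒫_γ·R̂` of the `M`-adic completion `R̂` of a local
ring `R`. -/
noncomputable def implicitIdeal {R K : Type*} [CommRing R] [IsLocalRing R] [CommRing K]
    (f : R →+* K) (ν : Valuation K ℝ≥0) (hν : ∀ x : R, ν (f x) ≤ 1) :
    Ideal (AdicCompletion (maximalIdeal R) R) :=
  ⨅ γ ∈ valSemigroup f ν,
    Ideal.map (algebraMap R (AdicCompletion (maximalIdeal R) R)) (valIdeal f ν hν γ)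

/-- If the maximal ideal of a noetherian local ring is contained in the radical of `I`, then `R ⧸ I`
has finite length as an `R`-module. -/
theorem isFiniteLength_quotient_of_maximalIdeal_le_radical {R : Type*} [CommRing R]
    [IsNoetherianRing R] [IsLocalRing R] {I : Ideal R} (hI : maximalIdeal R ≤ I.radical) :
    IsFiniteLength R (R ⧸ I) := by
  rw [isFiniteLength_iff_isNoetherian_isArtinian]
  refine ⟨inferInstance, ?_⟩
  by_cases hI' : I = ⊤
  · have : Subsingleton (R ⧸ I) := Ideal.Quotient.subsingleton_iff.mpr hI'
    infer_instance
  have hmin : maximalIdeal R ∈ I.minimalPrimes :=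
    ⟨⟨inferInstance, le_maximalIdeal hI'⟩, fun q hq _ ↦ hI.trans (hq.1.radical_le_iff.mpr hq.2)⟩
  have : IsArtinianRing (R ⧸ I) :=
    quotient_artinian_of_mem_minimalPrimes_of_isLocalRing I hmin
  let e : R ⧸ I →ₛₗ[Ideal.Quotient.mk I] R ⧸ I := ⟨.id _, fun _ _ ↦ rfl⟩
  exact (e.isArtinian_iff_of_bijective Function.bijective_id).mpr this

theorem mem_valIdeal {R K : Type*} [CommRing R] [CommRing K] {f : R →+* K}
    {ν : Valuation K ℝ≥0} {hν : ∀ x : R, ν (f x) ≤ 1} {γ : ℝ≥0} {x : R} :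
    x ∈ valIdeal f ν hν γ ↔ ν (f x) ≤ γ :=
  Iff.rfl

theorem valIdeal_mono {R K : Type*} [CommRing R] [CommRing K] (f : R →+* K)
    (ν : Valuation K ℝ≥0) (hν : ∀ x : R, ν (f x) ≤ 1) : Monotone (valIdeal f ν hν) :=
  fun _ _ h _ hx ↦ le_trans hx h

theorem le_radical_valIdeal {R K : Type*} [CommRing R] [CommRing K] (f : R →+* K)
    (ν : Valuation K ℝ≥0) (hν : ∀ x : R, ν (f x) ≤ 1) {J : Ideal R}
    (hJ : ∀ x ∈ J, ν (f x) < 1) {γ : ℝ≥0} (hγ : 0 < γ) :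
    J ≤ (valIdeal f ν hν γ).radical := by
  intro x hx
  obtain ⟨n, hn⟩ := NNReal.exists_pow_lt_of_lt_one hγ (hJ x hx)
  exact ⟨n, by simpa [mem_valIdeal] using hn.le⟩

/-- On the value semigroup, distinct values give distinct valuation ideals. -/
theorem valIdeal_lt_valIdeal {R K : Type*} [CommRing R] [CommRing K] (f : R →+* K)
    (ν : Valuation K ℝ≥0) (hν : ∀ x : R, ν (f x) ≤ 1) {γ δ : ℝ≥0} (hδ : δ ∈ valSemigroup f ν)
    (h : γ < δ) : valIdeal f ν hν γ < valIdeal f ν hν δ := by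
  obtain ⟨x, -, rfl⟩ := hδ
  exact lt_of_le_not_ge (valIdeal_mono f ν hν h.le) fun hle ↦ h.not_ge (hle (mem_valIdeal.mpr le_rfl))

/-- If `R ⧸ 𝒫_γ` has finite length, then only finitely many values are at least `γ`. -/
theorem finite_valSemigroup_ge_of_isFiniteLength {R K : Type*} [CommRing R] [CommRing K]
    (f : R →+* K) (ν : Valuation K ℝ≥0) (hν : ∀ x : R, ν (f x) ≤ 1) {γ : ℝ≥0}
    (h : IsFiniteLength R (R ⧸ valIdeal f ν hν γ)) :
    {δ ∈ valSemigroup f ν | γ ≤ δ}.Finite := by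
  obtain ⟨_, _⟩ := isFiniteLength_iff_isNoetherian_isArtinian.mp h
  let g : {δ ∈ valSemigroup f ν | γ ≤ δ} → Submodule R (R ⧸ valIdeal f ν hν γ) :=
    fun δ ↦ Submodule.map (valIdeal f ν hν γ).mkQ (valIdeal f ν hν δ)
  have hcomap (δ : {δ ∈ valSemigroup f ν | γ ≤ δ}) :
      (g δ).comap (valIdeal f ν hν γ).mkQ = valIdeal f ν hν δ := by
    simp only [g]
    rw [Submodule.comap_map_mkQ, sup_eq_right]
    exact valIdeal_mono f ν hν δ.2.2
  have hg : StrictMono g := by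
    intro δ ε hlt
    refine lt_of_le_not_ge (Submodule.map_mono (valIdeal_mono f ν hν hlt.le)) fun hle ↦ ?_
    have := Submodule.comap_mono (f := (valIdeal f ν hν γ).mkQ) hle
    rw [hcomap, hcomap] at this
    exact (valIdeal_lt_valIdeal f ν hν ε.2.1 hlt).not_ge this
  have := hg.wellFoundedLT
  have := hg.wellFoundedGT
  exact Set.finite_coe_iff.mp (Finite.of_wellFoundedLT_wellFoundedGT _)

/-- For every `γ ∈ ℝ≥0` with `0 < γ`, the `R`-module `R/𝒫_γ` has finite
length; consequently, for every `γ > 0` the set `{δ ∈ Φ | γ ≤ δ}` is finite (the value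
semigroup `Φ` contains no infinite bounded sequences; recall that the valuation is written
multiplicatively, so an additive upper bound corresponds to a multiplicative lower bound). -/
theorem finiteLength_quotient_valIdeal_and_bounded_values_finite
    (R : Type*) [CommRing R] [IsDomain R] [IsNoetherianRing R] [IsLocalRing R]
    (hR : ¬ IsField R)
    (ν : Valuation (FractionRing R) ℝ≥0)
    (hν1 : ∀ x : R, ν (algebraMap R (FractionRing R) x) ≤ 1)
    (hν2 : ∀ x ∈ maximalIdeal R, ν (algebraMap R (FractionRing R) x) < 1) :
    (∀ γ : ℝ≥0, 0 < γ →
      IsFiniteLength R (R ⧸ valIdeal (algebraMap R (FractionRing R)) ν hν1 γ)) ∧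
    (∀ γ : ℝ≥0, 0 < γ →
      {δ ∈ valSemigroup (algebraMap R (FractionRing R)) ν | γ ≤ δ}.Finite) := by
  have hfl (γ : ℝ≥0) (hγ : 0 < γ) :
      IsFiniteLength R (R ⧸ valIdeal (algebraMap R (FractionRing R)) ν hν1 γ) :=
    isFiniteLength_quotient_of_maximalIdeal_le_radical (le_radical_valIdeal _ ν hν1 hν2 hγ)
  exact ⟨hfl, fun γ hγ ↦ finite_valSemigroup_ge_of_isFiniteLength _ ν hν1 (hfl γ hγ)⟩
end

section
/- For every γ ∈ Φ, the preimage under π̂ of the extended valuation ideal 𝒫'_γ·R̂' equals 𝒫_γ·R̂; that is, π̂⁻¹(𝒫'_γ·R̂') = 𝒫_γ·R̂. -/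
/-!
Statement context. Let `(R, M)` be a noetherian local domain which is not a field, with field of
fractions `K`, and let `ν : K → ℝ≥0` be a (multiplicatively written) valuation which is ≤ 1 on `R`
and < 1 on `M` (i.e. `ν` is a nontrivial rank-one valuation centered at `R`).  For `γ ∈ ℝ≥0` let
`𝒫_γ = {x ∈ R | ν x ≤ γ}` and let `Φ = ν(R \ {0})`.  Then the implicit ideal
`H = ⋂_{γ ∈ Φ} 𝒫_γ·R̂` of the `M`-adic completion `R̂` of `R` is prime.
-/

open IsLocalRing
open scoped NNReal

/-- If `π(M) ⊆ M'` then `M^n ≤ (M'^n).comap π`. -/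
theorem pow_le_comap_pow {R R' : Type*} [CommRing R] [CommRing R'] {M : Ideal R} {M' : Ideal R'}
    (π : R →+* R') (h : ∀ x ∈ M, π x ∈ M') (n : ℕ) : M ^ n ≤ (M' ^ n).comap π := by
  rw [← Ideal.map_le_iff_le_comap, Ideal.map_pow]
  exact Ideal.pow_right_mono (Ideal.map_le_iff_le_comap.mpr h) n

/-- `πhat : R̂ → R̂'` is *the* ring homomorphism induced on the `M`-adic (resp. `M'`-adic)
completions by a local homomorphism `π : R → R'`: it is characterized by its compatibility
with the canonical projections `R̂ → R/Mⁿ`, `R̂' → R'/M'ⁿ` and the homomorphisms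
`R/Mⁿ → R'/M'ⁿ` induced by `π` (such a compatible homomorphism is unique, because an element
of an adic completion is determined by its images in all the quotients). -/
def IsInducedCompletionHom {R R' : Type*} [CommRing R] [CommRing R']
    [IsLocalRing R] [IsLocalRing R']
    (π : R →+* R') (hπ : ∀ x ∈ maximalIdeal R, π x ∈ maximalIdeal R')
    (πhat : AdicCompletion (maximalIdeal R) R →+* AdicCompletion (maximalIdeal R') R') : Prop :=
  ∀ (n : ℕ) (x : AdicCompletion (maximalIdeal R) R),
    AdicCompletion.evalₐ (maximalIdeal R') n (πhat x) =
      Ideal.quotientMap ((maximalIdeal R') ^ n) π (pow_le_comap_pow π hπ n)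
        (AdicCompletion.evalₐ (maximalIdeal R) n x)

/-- For `J ⊇ I ^ n` with `I` finitely generated, `J·Â` is the preimage of `J / I ^ n` under the
projection `Â → A / I ^ n`: membership can be tested on any representative modulo `I ^ n`. -/
theorem AdicCompletion.mem_map_algebraMap_iff_of_evalₐ_eq {A : Type*} [CommRing A] {I J : Ideal A}
    (hI : I.FG) {n : ℕ} (hJ : I ^ n ≤ J) {x : AdicCompletion I A} {a : A}
    (hx : AdicCompletion.evalₐ I n x = Ideal.Quotient.mk (I ^ n) a) :
    x ∈ J.map (algebraMap A (AdicCompletion I A)) ↔ a ∈ J := by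
  have heval : ∀ b : A, evalₐ I n (algebraMap A (AdicCompletion I A) b) =
      Ideal.Quotient.mk (I ^ n) b := fun b ↦ AlgHom.commutes _ b
  constructor
  · intro h
    have h' := Ideal.mem_map_of_mem (evalₐ I n).toRingHom h
    have hcomp : (evalₐ I n).toRingHom.comp (algebraMap A (AdicCompletion I A)) =
      Ideal.Quotient.mk (I ^ n) := RingHom.ext heval
    rw [Ideal.map_map, hcomp] at h'
    change evalₐ I n x ∈ _ at h'
    rwa [hx, Ideal.mem_quotient_iff_mem hJ] at h'
  · intro ha
    have hker : x - algebraMap A (AdicCompletion I A) a ∈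
        (I ^ n).map (algebraMap A (AdicCompletion I A)) := by
      have h0 : evalₐ I n (x - algebraMap A (AdicCompletion I A) a) = 0 := by
        rw [map_sub, hx, heval, sub_self]
      have hmem : x - algebraMap A (AdicCompletion I A) a ∈ (eval I A n).ker := by
        have hle : I ^ n ≤ I ^ n • ⊤ := by simp
        exact (factor_evalₐ_eq_eval I _ hle).symm.trans (by rw [h0, _root_.map_zero])
      rwa [← pow_smul_top_eq_ker_eval hI, Ideal.smul_top_eq_map] at hmem
    rw [← sub_add_cancel x (algebraMap A (AdicCompletion I A) a)]
    exact add_mem (Ideal.map_mono hJ hker) (Ideal.mem_map_of_mem _ ha)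

/-- If `ν` is `< 1` on a finitely generated ideal `I`, every valuation ideal of positive level
contains a power of `I`. -/
theorem exists_pow_le_valIdeal {A K : Type*} [CommRing A] [CommRing K] (f : A →+* K)
    (ν : Valuation K ℝ≥0) (hν : ∀ x : A, ν (f x) ≤ 1) {I : Ideal A} (hI : I.FG)
    (hνI : ∀ x ∈ I, ν (f x) < 1) {γ : ℝ≥0} (hγ : 0 < γ) :
    ∃ n : ℕ, I ^ n ≤ valIdeal f ν hν γ := by
  refine Ideal.exists_pow_le_of_le_radical_of_fg (fun x hx ↦ ?_) hI
  obtain ⟨k, hk⟩ := exists_pow_lt_of_lt_one hγ (hνI x hx)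
  refine ⟨k, ?_⟩
  change ν (f (x ^ k)) ≤ γ
  rw [map_pow, map_pow]
  exact hk.le

/-- For every `γ ∈ Φ`, the preimage under `π̂ : R̂ → R̂'` of the extended
valuation ideal `𝒫'_γ·R̂'` equals `𝒫_γ·R̂`.  Here `ν := ν' ∘ π` is the induced valuation on
`R`, and `π̂` is the homomorphism of `M`-adic completions induced by the local homomorphism
`π : R → R'`. -/
theorem comap_inducedCompletionHom_valIdeal
    (R R' : Type*) [CommRing R] [CommRing R'] [IsDomain R] [IsDomain R']
    [IsNoetherianRing R] [IsNoetherianRing R'] [IsLocalRing R] [IsLocalRing R']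
    (hR : ¬ IsField R) (hR' : ¬ IsField R')
    (π : R →+* R') (hinj : Function.Injective π)
    (hloc : ∀ x ∈ maximalIdeal R, π x ∈ maximalIdeal R')
    (ν' : Valuation (FractionRing R') ℝ≥0)
    (hν'1 : ∀ x : R', ν' (algebraMap R' (FractionRing R') x) ≤ 1)
    (hν'2 : ∀ x ∈ maximalIdeal R', ν' (algebraMap R' (FractionRing R') x) < 1)
    (πhat : AdicCompletion (maximalIdeal R) R →+* AdicCompletion (maximalIdeal R') R')
    (hπhat : IsInducedCompletionHom π hloc πhat)
    (γ : ℝ≥0)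
    (hγ : γ ∈ valSemigroup ((algebraMap R' (FractionRing R')).comp π) ν') :
    Ideal.comap πhat
        (Ideal.map (algebraMap R' (AdicCompletion (maximalIdeal R') R'))
          (valIdeal (algebraMap R' (FractionRing R')) ν' hν'1 γ)) =
      Ideal.map (algebraMap R (AdicCompletion (maximalIdeal R) R))
        (valIdeal ((algebraMap R' (FractionRing R')).comp π) ν'
          (fun x => hν'1 (π x)) γ) := by
  set f := algebraMap R' (FractionRing R')
  have hγ0 : 0 < γ := by
    obtain ⟨x, hx0, rfl⟩ := hγ
    rw [pos_iff_ne_zero, Valuation.ne_zero_iff]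
    have hf : Function.Injective (f.comp π) :=
      (IsFractionRing.injective R' (FractionRing R')).comp hinj
    exact (map_ne_zero_iff _ hf).mpr hx0
  obtain ⟨n, hn'⟩ := exists_pow_le_valIdeal f ν' hν'1 (maximalIdeal R').fg_of_isNoetherianRing
    hν'2 hγ0
  have hn : maximalIdeal R ^ n ≤ valIdeal (f.comp π) ν' (fun x ↦ hν'1 (π x)) γ :=
    fun x hx ↦ hn' (pow_le_comap_pow π hloc n hx)
  ext x
  obtain ⟨a, ha⟩ := Ideal.Quotient.mk_surjective (AdicCompletion.evalₐ (maximalIdeal R) n x)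
  have hx' : AdicCompletion.evalₐ (maximalIdeal R') n (πhat x) =
      Ideal.Quotient.mk (maximalIdeal R' ^ n) (π a) := by
    rw [hπhat, ← ha, Ideal.quotientMap_mk]
  rw [Ideal.mem_comap, AdicCompletion.mem_map_algebraMap_iff_of_evalₐ_eq
      (maximalIdeal R').fg_of_isNoetherianRing hn' hx',
    AdicCompletion.mem_map_algebraMap_iff_of_evalₐ_eq
      (maximalIdeal R).fg_of_isNoetherianRing hn ha.symm]
  rfl
end
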